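/- Let r₁ = (0,1)×(0,1), r₂ = (0,2)×(0,1), t₁ = { (x,y) : 0 < x, 0 < y, x + y < 2 }, and t₂ = { (x,y) : 0 < x, 0 < y, x + y < √2 } be open subsets of ℝ². For i = 1, 2, suppose u_{r_i} : ℝ² → ℝ and u_{t_i} : ℝ² → ℝ are each continuous on the closure of the respective region, twice continuously differentiable on it, satisfy ∂²u/∂x² + ∂²u/∂y² = −1 on the region, and vanish on its boundary. Then ∫_{r₁} u_{r₁} + ∫_{t₁} u_{t₁} < ∫_{r₂} u_{r₂} + ∫_{t₂} u_{t₂}; in particular the torsional rigidities of the disjoint unions C₁ = r₁ ∪ t₁ and C₂ = r₂ ∪ t₂ (taken with the components placed disjointly) are different. -/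

import Mathlib

open Real MeasureTheory

namespace Chapman

open scoped Pointwise

/-- the Laplacian written through iterated one-variable derivatives -/
noncomputable def lap (u : ℝ × ℝ → ℝ) (p : ℝ × ℝ) : ℝ :=
  deriv (fun x : ℝ => deriv (fun x' : ℝ => u (x', p.2)) x) p.1 +
    deriv (fun y : ℝ => deriv (fun y' : ℝ => u (p.1, y')) y) p.2

lemma deriv2_sub {f g : ℝ → ℝ} {x : ℝ} (hf : ContDiffAt ℝ 2 f x) (hg : ContDiffAt ℝ 2 g x) :
    deriv (fun t => deriv (fun s => f s - g s) t) x =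
      deriv (fun t => deriv f t) x - deriv (fun t => deriv g t) x := by
  have h : ∀ φ : ℝ → ℝ, deriv (fun t => deriv φ t) x = iteratedDeriv 2 φ x := by
    intro φ
    rw [iteratedDeriv_succ, iteratedDeriv_one]
  rw [h, h, h]
  exact iteratedDeriv_fun_sub hf hg

lemma deriv2_nonpos {f : ℝ → ℝ} {x : ℝ} (hf : ContDiffAt ℝ 2 f x) (hm : IsLocalMax f x) :
    deriv (fun t => deriv f t) x ≤ 0 := by
  by_contra hcon
  push Not at hcon
  have hmin : IsLocalMin f x :=
    isLocalMin_of_deriv_deriv_pos hcon hm.deriv_eq_zero hf.continuousAt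
  have he : f =ᶠ[nhds x] fun _ => f x := by
    filter_upwards [hm, hmin] with y h1 h2
    exact le_antisymm h1 h2
  have he2 : deriv f =ᶠ[nhds x] deriv (fun _ => f x) := he.deriv
  have := he2.deriv_eq
  simp at this
  linarith

lemma slice_fst {u : ℝ × ℝ → ℝ} {p : ℝ × ℝ} (hu : ContDiffAt ℝ 2 u p) :
    ContDiffAt ℝ 2 (fun x => u (x, p.2)) p.1 := by
  have : ContDiffAt ℝ 2 (fun x : ℝ => (x, p.2)) p.1 := by fun_prop
  exact ContDiffAt.comp (g := u) p.1 hu this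

lemma slice_snd {u : ℝ × ℝ → ℝ} {p : ℝ × ℝ} (hu : ContDiffAt ℝ 2 u p) :
    ContDiffAt ℝ 2 (fun y => u (p.1, y)) p.2 := by
  have : ContDiffAt ℝ 2 (fun y : ℝ => (p.1, y)) p.2 := by fun_prop
  exact ContDiffAt.comp (g := u) p.2 hu this

lemma lap_sub {u v : ℝ × ℝ → ℝ} {p : ℝ × ℝ} (hu : ContDiffAt ℝ 2 u p) (hv : ContDiffAt ℝ 2 v p) :
    lap (fun q => u q - v q) p = lap u p - lap v p := by
  unfold lap
  rw [deriv2_sub (slice_fst hu) (slice_fst hv), deriv2_sub (slice_snd hu) (slice_snd hv)]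
  ring

/-- strict maximum principle -/
lemma max_strict {D : Set (ℝ × ℝ)} (hD : IsOpen D) (hb : Bornology.IsBounded D)
    {v : ℝ × ℝ → ℝ} (hc : ContinuousOn v (closure D)) (hs : ContDiffOn ℝ 2 v D)
    (hl : ∀ p ∈ D, 0 < lap v p) {M : ℝ} (hf : ∀ p ∈ frontier D, v p ≤ M) :
    ∀ p ∈ D, v p ≤ M := by
  intro p hp
  obtain ⟨q, hq, hmax⟩ := hb.isCompact_closure.exists_isMaxOn ⟨p, subset_closure hp⟩ hc
  by_cases hqD : q ∈ D
  · exfalso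
    have hnq : D ∈ nhds q := hD.mem_nhds hqD
    have hcd : ContDiffAt ℝ 2 v q := (hs q hqD).contDiffAt hnq
    have hloc : IsLocalMax v q := by
      filter_upwards [hnq] with z hz
      exact hmax (subset_closure hz)
    have h1 : IsLocalMax (fun x => v (x, q.2)) q.1 := by
      have ht : Filter.Tendsto (fun x : ℝ => (x, q.2)) (nhds q.1) (nhds q) := by
        have : ContinuousAt (fun x : ℝ => (x, q.2)) q.1 := by fun_prop
        exact this
      exact ht.eventually hloc
    have h2 : IsLocalMax (fun y => v (q.1, y)) q.2 := by
      have ht : Filter.Tendsto (fun y : ℝ => (q.1, y)) (nhds q.2) (nhds q) := by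
        have : ContinuousAt (fun y : ℝ => (q.1, y)) q.2 := by fun_prop
        exact this
      exact ht.eventually hloc
    have a1 := deriv2_nonpos (slice_fst hcd) h1
    have a2 := deriv2_nonpos (slice_snd hcd) h2
    have := hl q hqD
    unfold lap at this
    linarith
  · have hqf : q ∈ frontier D := by
      rw [frontier, hD.interior_eq]; exact ⟨hq, hqD⟩
    exact (hmax (subset_closure hp)).trans (hf q hqf)

lemma lap_sq (ε : ℝ) (p : ℝ × ℝ) : lap (fun q => -(ε * q.1 ^ 2)) p = -(2 * ε) := by
  unfold lap
  have h : ∀ x : ℝ, deriv (fun x' : ℝ => -(ε * x' ^ 2)) x = -(ε * (2 * x)) := by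
    intro x
    have := (((hasDerivAt_id x).pow 2).const_mul ε).neg.deriv
    simpa using this
  have h2 : deriv (fun x : ℝ => -(ε * (2 * x))) p.1 = -(2 * ε) := by
    have := (((hasDerivAt_id p.1).const_mul 2).const_mul ε).neg.deriv
    simp only [id] at this
    calc _ = _ := this
      _ = _ := by ring
  simp only [h, h2]
  simp

/-- comparison principle -/
lemma comparison {D : Set (ℝ × ℝ)} (hD : IsOpen D) (hb : Bornology.IsBounded D)
    {u v : ℝ × ℝ → ℝ} (hcu : ContinuousOn u (closure D)) (hsu : ContDiffOn ℝ 2 u D)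
    (hcv : ContinuousOn v (closure D)) (hsv : ContDiffOn ℝ 2 v D)
    (hl : ∀ p ∈ D, lap v p ≤ lap u p) (hf : ∀ p ∈ frontier D, u p ≤ v p) :
    ∀ p ∈ D, u p ≤ v p := by
  intro p hp
  obtain ⟨R, hR⟩ : ∃ R, ∀ q ∈ closure D, q.1 ^ 2 ≤ R := by
    have hcc : ContinuousOn (fun q : ℝ × ℝ => q.1 ^ 2) (closure D) := by fun_prop
    obtain ⟨z, hz, hzm⟩ := hb.isCompact_closure.exists_isMaxOn ⟨p, subset_closure hp⟩ hcc
    exact ⟨z.1 ^ 2, fun q hq => hzm hq⟩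
  have key : ∀ ε > 0, u p - v p ≤ ε * R := by
    intro ε hε
    have hsq : ∀ q, ContDiffAt ℝ 2 (fun q : ℝ × ℝ => -(ε * q.1 ^ 2)) q := by
      intro q; fun_prop
    have := max_strict hD hb (v := fun q => (u q - v q) - (-(ε * q.1 ^ 2))) (M := ε * R)
      (by fun_prop) (by fun_prop)
      (by
        intro q hq
        have hu := (hsu q hq).contDiffAt (hD.mem_nhds hq)
        have hv := (hsv q hq).contDiffAt (hD.mem_nhds hq)
        rw [lap_sub (u := fun q => u q - v q) (hu.sub hv) (hsq q), lap_sub hu hv, lap_sq]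
        have := hl q hq
        linarith)
      (by
        intro q hq
        have h1 := hf q hq
        have h2 := mul_le_mul_of_nonneg_left (hR q (frontier_subset_closure hq)) hε.le
        linarith) p hp
    have h3 : 0 ≤ ε * p.1 ^ 2 := by positivity
    linarith
  have hlim : Filter.Tendsto (fun ε : ℝ => ε * R) (nhdsWithin 0 (Set.Ioi 0)) (nhds 0) := by
    have : Filter.Tendsto (fun ε : ℝ => ε * R) (nhds 0) (nhds (0 * R)) :=
      (continuous_id.mul continuous_const).tendsto 0
    rw [zero_mul] at this
    exact this.mono_left nhdsWithin_le_nhds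
  have := ge_of_tendsto hlim (b := u p - v p)
    (by filter_upwards [self_mem_nhdsWithin] with ε hε using key ε hε)
  linarith

/-! ### harmonic polynomials `P n + i Q n = (x + i y) ^ n` -/

mutual
def P : ℕ → ℝ → ℝ → ℝ
  | 0, _, _ => 1
  | n + 1, x, y => x * P n x y - y * Q n x y
def Q : ℕ → ℝ → ℝ → ℝ
  | 0, _, _ => 0
  | n + 1, x, y => x * Q n x y + y * P n x y
end

lemma P_zero (x y : ℝ) : P 0 x y = 1 := by rw [P]
lemma Q_zero (x y : ℝ) : Q 0 x y = 0 := by rw [Q]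
lemma P_succ (n : ℕ) (x y : ℝ) : P (n + 1) x y = x * P n x y - y * Q n x y := by rw [P]
lemma Q_succ (n : ℕ) (x y : ℝ) : Q (n + 1) x y = x * Q n x y + y * P n x y := by rw [Q]

lemma contDiff_PQ (n : ℕ) : ContDiff ℝ 2 (fun p : ℝ × ℝ => P n p.1 p.2) ∧
    ContDiff ℝ 2 (fun p : ℝ × ℝ => Q n p.1 p.2) := by
  induction n with
  | zero => simp only [P_zero, Q_zero]; exact ⟨contDiff_const, contDiff_const⟩
  | succ n ih =>
    obtain ⟨h1, h2⟩ := ih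
    simp only [P_succ, Q_succ]
    constructor <;> fun_prop

lemma dx (n : ℕ) (x y : ℝ) :
    HasDerivAt (fun t => P n t y) (n * P (n - 1) x y) x ∧
    HasDerivAt (fun t => Q n t y) (n * Q (n - 1) x y) x := by
  induction n with
  | zero =>
    simp only [P_zero, Q_zero]
    constructor <;> simpa using hasDerivAt_const x _
  | succ n ih =>
    obtain ⟨h1, h2⟩ := ih
    simp only [P_succ, Q_succ]
    constructor
    · refine (((hasDerivAt_id' x).mul h1).sub (h2.const_mul y)).congr_deriv ?_
      rcases n with _ | n
      · simp [P_zero]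
      · simp [P_succ, Q_succ]; ring
    · refine (((hasDerivAt_id' x).mul h2).add (h1.const_mul y)).congr_deriv ?_
      rcases n with _ | n
      · simp [P_zero, Q_zero]
      · simp [P_succ, Q_succ]; ring

lemma dy (n : ℕ) (x y : ℝ) :
    HasDerivAt (fun t => P n x t) (-(n * Q (n - 1) x y)) y ∧
    HasDerivAt (fun t => Q n x t) (n * P (n - 1) x y) y := by
  induction n with
  | zero =>
    simp only [P_zero, Q_zero]
    constructor <;> simpa using hasDerivAt_const y _
  | succ n ih =>
    obtain ⟨h1, h2⟩ := ih
    simp only [P_succ, Q_succ]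
    constructor
    · refine ((h1.const_mul x).sub ((hasDerivAt_id' y).mul h2)).congr_deriv ?_
      rcases n with _ | n
      · simp [P_zero, Q_zero]
      · simp [P_succ, Q_succ]; ring
    · refine ((h2.const_mul x).add ((hasDerivAt_id' y).mul h1)).congr_deriv ?_
      rcases n with _ | n
      · simp [P_zero, Q_zero]
      · simp [P_succ, Q_succ]; ring

/-- derivative along the line `(t, 1 - t)` -/
lemma dl (n : ℕ) (x : ℝ) :
    HasDerivAt (fun t => P n t (1 - t)) (n * (P (n - 1) x (1 - x) + Q (n - 1) x (1 - x))) x ∧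
    HasDerivAt (fun t => Q n t (1 - t)) (n * (Q (n - 1) x (1 - x) - P (n - 1) x (1 - x))) x := by
  have hl : HasDerivAt (fun t : ℝ => 1 - t) (-1) x := by
    simpa using (hasDerivAt_id' x).const_sub 1
  induction n with
  | zero =>
    simp only [P_zero, Q_zero]
    constructor <;> simpa using hasDerivAt_const x _
  | succ n ih =>
    obtain ⟨h1, h2⟩ := ih
    simp only [P_succ, Q_succ]
    constructor
    · refine (((hasDerivAt_id' x).mul h1).sub (hl.mul h2)).congr_deriv ?_
      rcases n with _ | n
      · simp [P_zero, Q_zero]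
      · simp [P_succ, Q_succ]; ring
    · refine (((hasDerivAt_id' x).mul h2).add (hl.mul h1)).congr_deriv ?_
      rcases n with _ | n
      · simp [P_zero, Q_zero]
      · simp [P_succ, Q_succ]; ring

/-- barrier: harmonic polynomial plus the particular solution `-(x²+y²)/4` -/
noncomputable def W (a b : ℕ → ℝ) (N : ℕ) (x y : ℝ) : ℝ :=
  (∑ k ∈ Finset.range N, (a k * P k x y + b k * Q k x y)) - (x ^ 2 + y ^ 2) / 4

lemma contDiff_W (a b : ℕ → ℝ) (N : ℕ) : ContDiff ℝ 2 (fun p : ℝ × ℝ => W a b N p.1 p.2) := by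
  unfold W
  have h1 := fun n => (contDiff_PQ n).1
  have h2 := fun n => (contDiff_PQ n).2
  refine ContDiff.sub (ContDiff.sum fun k _ => ?_) (by fun_prop)
  exact (contDiff_const.mul (h1 k)).add (contDiff_const.mul (h2 k))

lemma W_dx (a b : ℕ → ℝ) (N : ℕ) (x y : ℝ) : HasDerivAt (fun t => W a b N t y)
    ((∑ k ∈ Finset.range N, (a k * (k * P (k - 1) x y) + b k * (k * Q (k - 1) x y))) - x / 2) x := by
  unfold W
  refine HasDerivAt.sub (HasDerivAt.fun_sum fun k _ => ?_) ?_
  · exact ((dx k x y).1.const_mul _).add ((dx k x y).2.const_mul _)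
  · refine ((((hasDerivAt_id' x).pow 2).add_const (y ^ 2)).div_const 4).congr_deriv ?_
    norm_num; ring

lemma W_dxx (a b : ℕ → ℝ) (N : ℕ) (x y : ℝ) : HasDerivAt (fun x =>
    ((∑ k ∈ Finset.range N, (a k * (k * P (k - 1) x y) + b k * (k * Q (k - 1) x y))) - x / 2))
    ((∑ k ∈ Finset.range N, (a k * (k * ((k - 1 : ℕ) * P (k - 1 - 1) x y)) +
      b k * (k * ((k - 1 : ℕ) * Q (k - 1 - 1) x y)))) - 1 / 2) x := by
  refine HasDerivAt.sub (HasDerivAt.fun_sum fun k _ => ?_) ((hasDerivAt_id' x).div_const 2)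
  exact (((dx (k - 1) x y).1.const_mul _).const_mul _).add
    (((dx (k - 1) x y).2.const_mul _).const_mul _)

lemma W_dy (a b : ℕ → ℝ) (N : ℕ) (x y : ℝ) : HasDerivAt (fun t => W a b N x t)
    ((∑ k ∈ Finset.range N, (a k * (-(k * Q (k - 1) x y)) + b k * (k * P (k - 1) x y))) - y / 2) y := by
  unfold W
  refine HasDerivAt.sub (HasDerivAt.fun_sum fun k _ => ?_) ?_
  · exact ((dy k x y).1.const_mul _).add ((dy k x y).2.const_mul _)
  · refine ((((hasDerivAt_id' y).pow 2).const_add (x ^ 2)).div_const 4).congr_deriv ?_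
    norm_num; ring

lemma W_dyy (a b : ℕ → ℝ) (N : ℕ) (x y : ℝ) : HasDerivAt (fun y =>
    ((∑ k ∈ Finset.range N, (a k * (-(k * Q (k - 1) x y)) + b k * (k * P (k - 1) x y))) - y / 2))
    (-(∑ k ∈ Finset.range N, (a k * (k * ((k - 1 : ℕ) * P (k - 1 - 1) x y)) +
      b k * (k * ((k - 1 : ℕ) * Q (k - 1 - 1) x y)))) - 1 / 2) y := by
  rw [← Finset.sum_neg_distrib]
  refine HasDerivAt.sub (HasDerivAt.fun_sum fun k _ => ?_) ((hasDerivAt_id' y).div_const 2)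
  refine ((((dy (k - 1) x y).2.const_mul _).neg.const_mul _).add
    (((dy (k - 1) x y).1.const_mul _).const_mul _)).congr_deriv ?_
  ring

lemma lap_W (a b : ℕ → ℝ) (N : ℕ) (x₀ y₀ : ℝ) (p : ℝ × ℝ) :
    lap (fun q => W a b N (q.1 - x₀) (q.2 - y₀)) p = -1 := by
  unfold lap
  have h1 : ∀ x, deriv (fun x' : ℝ => W a b N (x' - x₀) (p.2 - y₀)) x = _ := fun x =>
    ((W_dx a b N (x - x₀) (p.2 - y₀)).comp_sub_const x x₀).deriv
  have h2 : ∀ y, deriv (fun y' : ℝ => W a b N (p.1 - x₀) (y' - y₀)) y = _ := fun y =>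
    ((W_dy a b N (p.1 - x₀) (y - y₀)).comp_sub_const y y₀).deriv
  simp only [h1, h2]
  rw [((W_dxx a b N (p.1 - x₀) (p.2 - y₀)).comp_sub_const p.1 x₀).deriv,
    ((W_dyy a b N (p.1 - x₀) (p.2 - y₀)).comp_sub_const p.2 y₀).deriv]
  ring

lemma contDiff_Ws (a b : ℕ → ℝ) (N : ℕ) (x₀ y₀ : ℝ) :
    ContDiff ℝ 2 (fun q : ℝ × ℝ => W a b N (q.1 - x₀) (q.2 - y₀)) := by
  have h : ContDiff ℝ 2 (fun q : ℝ × ℝ => (q.1 - x₀, q.2 - y₀)) := by fun_prop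
  exact (contDiff_W a b N).comp h

/-- `y`-primitive of `W` -/
noncomputable def W1 (a b : ℕ → ℝ) (N : ℕ) (x y : ℝ) : ℝ :=
  (∑ k ∈ Finset.range N, (a k * Q (k + 1) x y - b k * P (k + 1) x y) / (k + 1)) -
    (x ^ 2 * y + y ^ 3 / 3) / 4

lemma W1_dy (a b : ℕ → ℝ) (N : ℕ) (x y : ℝ) :
    HasDerivAt (fun t => W1 a b N x t) (W a b N x y) y := by
  unfold W1 W
  refine HasDerivAt.sub (HasDerivAt.fun_sum fun k _ => ?_) ?_
  · refine ((((dy (k + 1) x y).2.const_mul _).sub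
      ((dy (k + 1) x y).1.const_mul _)).div_const _).congr_deriv ?_
    have : (k : ℝ) + 1 ≠ 0 := by positivity
    push_cast
    try simp only [Nat.add_sub_cancel_right, Nat.add_one_sub_one]
    field_simp
    ring
  · refine ((((hasDerivAt_id' y).const_mul _).add
      (((hasDerivAt_id' y).pow 3).div_const 3)).div_const 4).congr_deriv ?_
    norm_num

/-- `x`-primitive of `W1` -/
noncomputable def W2 (a b : ℕ → ℝ) (N : ℕ) (x y : ℝ) : ℝ :=
  (∑ k ∈ Finset.range N, (a k * Q (k + 2) x y - b k * P (k + 2) x y) / ((k + 1) * (k + 2))) -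
    (x ^ 3 / 3 * y + x * (y ^ 3 / 3)) / 4

lemma W2_dx (a b : ℕ → ℝ) (N : ℕ) (x y : ℝ) :
    HasDerivAt (fun t => W2 a b N t y) (W1 a b N x y) x := by
  unfold W1 W2
  refine HasDerivAt.sub (HasDerivAt.fun_sum fun k _ => ?_) ?_
  · refine ((((dx (k + 2) x y).2.const_mul _).sub
      ((dx (k + 2) x y).1.const_mul _)).div_const _).congr_deriv ?_
    have : (k : ℝ) + 1 ≠ 0 := by positivity
    have : (k : ℝ) + 2 ≠ 0 := by positivity
    push_cast
    try simp only [show k + 2 - 1 = k + 1 by omega]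
    field_simp
  · refine ((((((hasDerivAt_id' x).pow 3).div_const 3).mul_const y).add
      ((hasDerivAt_id' x).mul_const _)).div_const 4).congr_deriv ?_
    norm_num

/-- primitive of `W1` along the line `(t, 1 - t)` -/
noncomputable def W3 (a b : ℕ → ℝ) (N : ℕ) (x : ℝ) : ℝ :=
  (∑ k ∈ Finset.range N, (a k * (P (k + 2) x (1 - x) + Q (k + 2) x (1 - x)) / 2
    - b k * (P (k + 2) x (1 - x) - Q (k + 2) x (1 - x)) / 2) / ((k + 1) * (k + 2))) -
    (x ^ 3 / 3 - x ^ 4 / 4 - (1 - x) ^ 4 / 12) / 4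

lemma W3_d (a b : ℕ → ℝ) (N : ℕ) (x : ℝ) :
    HasDerivAt (fun t => W3 a b N t) (W1 a b N x (1 - x)) x := by
  have hl : HasDerivAt (fun t : ℝ => 1 - t) (-1) x := by
    simpa using (hasDerivAt_id' x).const_sub 1
  unfold W1 W3
  refine HasDerivAt.sub (HasDerivAt.fun_sum fun k _ => ?_) ?_
  · have hp := (dl (k + 2) x).1
    have hq := (dl (k + 2) x).2
    refine ((((((hp.add hq).const_mul (a k)).div_const 2).sub
      (((hp.sub hq).const_mul (b k)).div_const 2))).div_const _).congr_deriv ?_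
    have : (k : ℝ) + 1 ≠ 0 := by positivity
    have : (k : ℝ) + 2 ≠ 0 := by positivity
    push_cast
    try simp only [show k + 2 - 1 = k + 1 by omega]
    field_simp
    ring
  · refine ((((((hasDerivAt_id' x).pow 3).div_const 3).sub
      (((hasDerivAt_id' x).pow 4).div_const 4)).sub ((hl.pow 4).div_const 12)).div_const
        4).congr_deriv ?_
    norm_num; ring

lemma continuous_W (a b : ℕ → ℝ) (N : ℕ) (x₀ y₀ : ℝ) :
    Continuous (fun q : ℝ × ℝ => W a b N (q.1 - x₀) (q.2 - y₀)) := (contDiff_Ws a b N x₀ y₀).continuous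

lemma integral_W_inner (a b : ℕ → ℝ) (N : ℕ) (x c d : ℝ) :
    ∫ y in c..d, W a b N x y = W1 a b N x d - W1 a b N x c := by
  apply intervalIntegral.integral_eq_sub_of_hasDerivAt (fun y _ => W1_dy a b N x y)
  apply Continuous.intervalIntegrable
  exact (contDiff_W a b N).continuous.comp (by fun_prop : Continuous fun y : ℝ => (x, y))

lemma continuous_W1 (a b : ℕ → ℝ) (N : ℕ) : Continuous (fun p : ℝ × ℝ => W1 a b N p.1 p.2) := by
  unfold W1
  have h1 := fun n => (contDiff_PQ n).1.continuous
  have h2 := fun n => (contDiff_PQ n).2.continuous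
  refine Continuous.sub (continuous_finsetSum _ fun k _ => ?_) (by fun_prop)
  exact ((continuous_const.mul (h2 _)).sub (continuous_const.mul (h1 _))).div_const _

lemma integral_W_rect (a b : ℕ → ℝ) (N : ℕ) (x₀ y₀ A B : ℝ) (hA : 0 ≤ A) (hB : 0 ≤ B) :
    ∫ q in Set.Ioo (0 : ℝ) A ×ˢ Set.Ioo (0 : ℝ) B, W a b N (q.1 - x₀) (q.2 - y₀) =
      W2 a b N (A - x₀) (B - y₀) - W2 a b N (-x₀) (B - y₀)
        - (W2 a b N (A - x₀) (-y₀) - W2 a b N (-x₀) (-y₀)) := by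
  have hint : IntegrableOn (fun q : ℝ × ℝ => W a b N (q.1 - x₀) (q.2 - y₀))
      (Set.Ioo (0 : ℝ) A ×ˢ Set.Ioo (0 : ℝ) B) (volume.prod volume) := by
    have : IntegrableOn (fun q : ℝ × ℝ => W a b N (q.1 - x₀) (q.2 - y₀))
      (Set.Icc (0 : ℝ) A ×ˢ Set.Icc (0 : ℝ) B) :=
      (continuous_W a b N x₀ y₀).continuousOn.integrableOn_compact (isCompact_Icc.prod isCompact_Icc)
    exact this.mono_set (Set.prod_mono Set.Ioo_subset_Icc_self Set.Ioo_subset_Icc_self)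
  rw [Measure.volume_eq_prod, setIntegral_prod _ hint]
  have hi : ∀ x, ∫ y in Set.Ioo (0 : ℝ) B, W a b N (x - x₀) (y - y₀) =
      W1 a b N (x - x₀) (B - y₀) - W1 a b N (x - x₀) (-y₀) := by
    intro x
    rw [← integral_Ioc_eq_integral_Ioo, ← intervalIntegral.integral_of_le hB,
      intervalIntegral.integral_comp_sub_right (fun y => W a b N (x - x₀) y), integral_W_inner,
      zero_sub]
  simp only [hi]
  rw [← integral_Ioc_eq_integral_Ioo, ← intervalIntegral.integral_of_le hA,
    intervalIntegral.integral_comp_sub_right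
      (fun x => W1 a b N x (B - y₀) - W1 a b N x (-y₀)), zero_sub]
  rw [intervalIntegral.integral_eq_sub_of_hasDerivAt
    (fun x _ => (W2_dx a b N x (B - y₀)).sub (W2_dx a b N x (-y₀)))]
  · simp only [Pi.sub_apply]; ring
  · apply Continuous.intervalIntegrable
    exact ((continuous_W1 a b N).comp (by fun_prop : Continuous fun x : ℝ => (x, B - y₀))).sub
      ((continuous_W1 a b N).comp (by fun_prop : Continuous fun x : ℝ => (x, -y₀)))

/-- the right isosceles triangle with legs of length `c` -/
def tri (c : ℝ) : Set (ℝ × ℝ) := {p : ℝ × ℝ | 0 < p.1 ∧ 0 < p.2 ∧ p.1 + p.2 < c}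

lemma isOpen_tri (c : ℝ) : IsOpen (tri c) := by
  have h1 : IsOpen {p : ℝ × ℝ | 0 < p.1} := isOpen_lt (by fun_prop) (by fun_prop)
  have h2 : IsOpen {p : ℝ × ℝ | 0 < p.2} := isOpen_lt (by fun_prop) (by fun_prop)
  have h3 : IsOpen {p : ℝ × ℝ | p.1 + p.2 < c} := isOpen_lt (by fun_prop) (by fun_prop)
  exact h1.inter (h2.inter h3)

lemma tri_subset (c : ℝ) : tri c ⊆ Set.Icc (0 : ℝ) c ×ˢ Set.Icc (0 : ℝ) c := by
  rintro ⟨x, y⟩ ⟨h1, h2, h3⟩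
  simp only at h1 h2 h3
  exact ⟨⟨by simpa using h1.le, by simp only; linarith⟩, ⟨by simpa using h2.le, by simp only; linarith⟩⟩

lemma isBounded_tri (c : ℝ) : Bornology.IsBounded (tri c) :=
  (isCompact_Icc.prod isCompact_Icc).isBounded.subset (tri_subset c)

lemma closure_tri (c : ℝ) : closure (tri c) ⊆ {p : ℝ × ℝ | 0 ≤ p.1 ∧ 0 ≤ p.2 ∧ p.1 + p.2 ≤ c} := by
  apply closure_minimal
  · rintro p ⟨h1, h2, h3⟩; exact ⟨h1.le, h2.le, h3.le⟩
  · have h1 : IsClosed {p : ℝ × ℝ | 0 ≤ p.1} := isClosed_le (by fun_prop) (by fun_prop)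
    have h2 : IsClosed {p : ℝ × ℝ | 0 ≤ p.2} := isClosed_le (by fun_prop) (by fun_prop)
    have h3 : IsClosed {p : ℝ × ℝ | p.1 + p.2 ≤ c} := isClosed_le (by fun_prop) (by fun_prop)
    exact h1.inter (h2.inter h3)

lemma integral_W_tri (a b : ℕ → ℝ) (N : ℕ) :
    ∫ q in tri 1, W a b N q.1 q.2 =
      W3 a b N 1 - W3 a b N 0 - (W2 a b N 1 0 - W2 a b N 0 0) := by
  have hint : IntegrableOn (fun q : ℝ × ℝ => W a b N q.1 q.2) (tri 1) (volume.prod volume) := by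
    have : IntegrableOn (fun q : ℝ × ℝ => W a b N q.1 q.2)
      (Set.Icc (0 : ℝ) 1 ×ˢ Set.Icc (0 : ℝ) 1) :=
      (contDiff_W a b N).continuous.continuousOn.integrableOn_compact
        (isCompact_Icc.prod isCompact_Icc)
    exact this.mono_set (tri_subset 1)
  have hm : MeasurableSet (tri 1) := (isOpen_tri 1).measurableSet
  rw [Measure.volume_eq_prod, ← integral_indicator hm, integral_prod _ ((integrable_indicator_iff hm).2 hint)]
  have hi : ∀ x : ℝ, ∫ y, (tri 1).indicator (fun q : ℝ × ℝ => W a b N q.1 q.2) (x, y) =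
      (Set.Ioo (0 : ℝ) 1).indicator (fun x => W1 a b N x (1 - x) - W1 a b N x 0) x := by
    intro x
    by_cases hx : x ∈ Set.Ioo (0 : ℝ) 1
    · rw [Set.indicator_of_mem hx, ← integral_W_inner,
        intervalIntegral.integral_of_le (by linarith [hx.2]), integral_Ioc_eq_integral_Ioo,
        ← integral_indicator measurableSet_Ioo]
      congr 1
      ext y
      by_cases hy : y ∈ Set.Ioo (0 : ℝ) (1 - x)
      · rw [Set.indicator_of_mem hy, Set.indicator_of_mem]
        exact ⟨hx.1, hy.1, by have := hy.2; simp only; linarith⟩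
      · rw [Set.indicator_of_notMem hy, Set.indicator_of_notMem]
        rintro ⟨_, h2, h3⟩
        simp only at h2 h3
        exact hy ⟨h2, by linarith⟩
    · rw [Set.indicator_of_notMem hx]
      have : ∀ y, (tri 1).indicator (fun q : ℝ × ℝ => W a b N q.1 q.2) (x, y) = 0 := by
        intro y
        rw [Set.indicator_of_notMem]
        rintro ⟨h1, h2, h3⟩
        simp only at h1 h2 h3
        exact hx ⟨h1, by linarith⟩
      simp [this]
  simp only [hi]
  rw [integral_indicator measurableSet_Ioo, ← integral_Ioc_eq_integral_Ioo,
    ← intervalIntegral.integral_of_le zero_le_one]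
  rw [intervalIntegral.integral_eq_sub_of_hasDerivAt
    (fun x _ => (W3_d a b N x).sub (W2_dx a b N x 0))]
  · simp only [Pi.sub_apply]; ring
  · apply Continuous.intervalIntegrable
    exact ((continuous_W1 a b N).comp (by fun_prop : Continuous fun x : ℝ => (x, 1 - x))).sub
      ((continuous_W1 a b N).comp (by fun_prop : Continuous fun x : ℝ => (x, (0 : ℝ))))

lemma integrableOn_of {D : Set (ℝ × ℝ)} (hb : Bornology.IsBounded D) {u : ℝ × ℝ → ℝ}
    (hc : ContinuousOn u (closure D)) : IntegrableOn u D :=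
  (hc.integrableOn_compact hb.isCompact_closure).mono_set subset_closure

lemma integral_le {D : Set (ℝ × ℝ)} (hD : IsOpen D) (hb : Bornology.IsBounded D)
    {u v : ℝ × ℝ → ℝ} (hcu : ContinuousOn u (closure D)) (hsu : ContDiffOn ℝ 2 u D)
    (hcv : ContinuousOn v (closure D)) (hsv : ContDiffOn ℝ 2 v D)
    (hl : ∀ p ∈ D, lap v p ≤ lap u p) (hf : ∀ p ∈ frontier D, u p ≤ v p) :
    ∫ p in D, u p ≤ ∫ p in D, v p :=
  setIntegral_mono_on (integrableOn_of hb hcu) (integrableOn_of hb hcv) hD.measurableSet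
    (comparison hD hb hcu hsu hcv hsv hl hf)

/-- torsion function on `D` -/
def IsTor (D : Set (ℝ × ℝ)) (u : ℝ × ℝ → ℝ) : Prop :=
  ContinuousOn u (closure D) ∧ ContDiffOn ℝ 2 u D ∧ (∀ p ∈ D, lap u p = -1) ∧
    ∀ p ∈ frontier D, u p = 0

lemma IsTor.integral_eq {D : Set (ℝ × ℝ)} (hD : IsOpen D) (hb : Bornology.IsBounded D)
    {u v : ℝ × ℝ → ℝ} (hu : IsTor D u) (hv : IsTor D v) : ∫ p in D, u p = ∫ p in D, v p := by
  obtain ⟨a1, a2, a3, a4⟩ := hu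
  obtain ⟨b1, b2, b3, b4⟩ := hv
  apply le_antisymm
  · exact integral_le hD hb a1 a2 b1 b2 (fun p hp => by rw [a3 p hp, b3 p hp])
      (fun p hp => by rw [a4 p hp, b4 p hp])
  · exact integral_le hD hb b1 b2 a1 a2 (fun p hp => by rw [a3 p hp, b3 p hp])
      (fun p hp => by rw [a4 p hp, b4 p hp])

lemma smul_tri {c : ℝ} (hc : 0 < c) : tri c = c • tri 1 := by
  ext p
  rw [Set.mem_smul_set_iff_inv_smul_mem₀ hc.ne']
  have h : ∀ t : ℝ, 0 < c⁻¹ * t ↔ 0 < t := fun t => by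
    rw [mul_pos_iff_of_pos_left (inv_pos.2 hc)]
  simp only [tri, Set.mem_setOf_eq, Prod.smul_fst, Prod.smul_snd, smul_eq_mul, h]
  rw [← mul_add, inv_mul_lt_iff₀ hc, mul_one]

lemma tor_scale {c : ℝ} (hc : 0 < c) {u : ℝ × ℝ → ℝ} (hu : IsTor (tri c) u) :
    IsTor (tri 1) (fun p => (c ^ 2)⁻¹ * u (c • p)) ∧
      ∫ p in tri c, u p = c ^ 4 * ∫ p in tri 1, (c ^ 2)⁻¹ * u (c • p) := by
  obtain ⟨h1, h2, h3, h4⟩ := hu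
  rw [smul_tri hc] at h1 h2 h3 h4 ⊢
  have hcl : closure (c • tri 1) = c • closure (tri 1) := closure_smul₀ c _
  have hfr : ∀ p ∈ frontier (tri 1), c • p ∈ frontier (c • tri 1) := by
    intro p hp
    have : frontier (c • tri 1) = c • frontier (tri 1) := by
      have := (Homeomorph.smulOfNeZero c hc.ne' (α := ℝ × ℝ)).image_frontier (tri 1)
      exact this.symm
    rw [this]; exact Set.smul_mem_smul_set hp
  refine ⟨⟨?_, ?_, ?_, ?_⟩, ?_⟩
  · refine continuousOn_const.mul (h1.comp (by fun_prop) ?_)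
    intro p hp; rw [hcl]; exact Set.smul_mem_smul_set hp
  · refine contDiffOn_const.mul (h2.comp (by fun_prop) ?_)
    intro p hp; exact Set.smul_mem_smul_set hp
  · intro p hp
    have := h3 (c • p) (Set.smul_mem_smul_set hp)
    unfold lap at this ⊢
    simp only [Prod.smul_mk, Prod.smul_fst, Prod.smul_snd, smul_eq_mul] at this ⊢
    have e1 : ∀ x, deriv (fun x' => (c ^ 2)⁻¹ * u (c * x', c * p.2)) x =
        (c ^ 2)⁻¹ * (c * deriv (fun x' => u (x', c * p.2)) (c * x)) := by
      intro x
      rw [deriv_const_mul_field, deriv_comp_mul_left c (fun x' => u (x', c * p.2)), smul_eq_mul]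
    have e2 : ∀ y, deriv (fun y' => (c ^ 2)⁻¹ * u (c * p.1, c * y')) y =
        (c ^ 2)⁻¹ * (c * deriv (fun y' => u (c * p.1, y')) (c * y)) := by
      intro y
      rw [deriv_const_mul_field, deriv_comp_mul_left c (fun y' => u (c * p.1, y')), smul_eq_mul]
    simp only [e1, e2, deriv_const_mul_field]
    rw [deriv_comp_mul_left c (fun x => deriv (fun x' => u (x', c * p.2)) x),
      deriv_comp_mul_left c (fun y => deriv (fun y' => u (c * p.1, y')) y), smul_eq_mul, smul_eq_mul]
    field_simp
    linarith
  · intro p hp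
    simp only [h4 _ (hfr p hp), mul_zero]
  · rw [integral_const_mul, Measure.setIntegral_comp_smul volume u (tri 1) hc.ne']
    have : Module.finrank ℝ (ℝ × ℝ) = 2 := by simp
    rw [this, abs_of_pos (by positivity), smul_eq_mul]
    field_simp
lemma P1 (x y : ℝ) : P 1 x y = x := by simp [P_succ, P_zero, Q_zero]
lemma Q1 (x y : ℝ) : Q 1 x y = y := by simp [Q_succ, P_zero, Q_zero]
lemma P2 (x y : ℝ) : P 2 x y =
    x ^ 2 - y ^ 2 := by
  rw [P_succ, P1, Q1]; ring
lemma Q2 (x y : ℝ) : Q 2 x y =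
    2 * x * y := by
  rw [Q_succ, P1, Q1]; ring
lemma P3 (x y : ℝ) : P 3 x y =
    x ^ 3 - 3 * x * y ^ 2 := by
  rw [P_succ, P2, Q2]; ring
lemma Q3 (x y : ℝ) : Q 3 x y =
    3 * x ^ 2 * y - y ^ 3 := by
  rw [Q_succ, P2, Q2]; ring
lemma P4 (x y : ℝ) : P 4 x y =
    x ^ 4 - 6 * x ^ 2 * y ^ 2 + y ^ 4 := by
  rw [P_succ, P3, Q3]; ring
lemma Q4 (x y : ℝ) : Q 4 x y =
    4 * x ^ 3 * y - 4 * x * y ^ 3 := by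
  rw [Q_succ, P3, Q3]; ring
lemma P5 (x y : ℝ) : P 5 x y =
    x ^ 5 - 10 * x ^ 3 * y ^ 2 + 5 * x * y ^ 4 := by
  rw [P_succ, P4, Q4]; ring
lemma Q5 (x y : ℝ) : Q 5 x y =
    5 * x ^ 4 * y - 10 * x ^ 2 * y ^ 3 + y ^ 5 := by
  rw [Q_succ, P4, Q4]; ring
lemma P6 (x y : ℝ) : P 6 x y =
    x ^ 6 - 15 * x ^ 4 * y ^ 2 + 15 * x ^ 2 * y ^ 4 - y ^ 6 := by
  rw [P_succ, P5, Q5]; ring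
lemma Q6 (x y : ℝ) : Q 6 x y =
    6 * x ^ 5 * y - 20 * x ^ 3 * y ^ 3 + 6 * x * y ^ 5 := by
  rw [Q_succ, P5, Q5]; ring
lemma P7 (x y : ℝ) : P 7 x y =
    x ^ 7 - 21 * x ^ 5 * y ^ 2 + 35 * x ^ 3 * y ^ 4 - 7 * x * y ^ 6 := by
  rw [P_succ, P6, Q6]; ring
lemma Q7 (x y : ℝ) : Q 7 x y =
    7 * x ^ 6 * y - 35 * x ^ 4 * y ^ 3 + 21 * x ^ 2 * y ^ 5 - y ^ 7 := by
  rw [Q_succ, P6, Q6]; ring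
lemma P8 (x y : ℝ) : P 8 x y =
    x ^ 8 - 28 * x ^ 6 * y ^ 2 + 70 * x ^ 4 * y ^ 4 - 28 * x ^ 2 * y ^ 6 + y ^ 8 := by
  rw [P_succ, P7, Q7]; ring
lemma Q8 (x y : ℝ) : Q 8 x y =
    8 * x ^ 7 * y - 56 * x ^ 5 * y ^ 3 + 56 * x ^ 3 * y ^ 5 - 8 * x * y ^ 7 := by
  rw [Q_succ, P7, Q7]; ring
lemma P9 (x y : ℝ) : P 9 x y =
    x ^ 9 - 36 * x ^ 7 * y ^ 2 + 126 * x ^ 5 * y ^ 4 - 84 * x ^ 3 * y ^ 6 + 9 * x * y ^ 8 := by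
  rw [P_succ, P8, Q8]; ring
lemma Q9 (x y : ℝ) : Q 9 x y =
    9 * x ^ 8 * y - 84 * x ^ 6 * y ^ 3 + 126 * x ^ 4 * y ^ 5 - 36 * x ^ 2 * y ^ 7 + y ^ 9 := by
  rw [Q_succ, P8, Q8]; ring
lemma P10 (x y : ℝ) : P 10 x y =
    x ^ 10 - 45 * x ^ 8 * y ^ 2 + 210 * x ^ 6 * y ^ 4 - 210 * x ^ 4 * y ^ 6 + 45 * x ^ 2 * y ^ 8 - y ^ 10 := by
  rw [P_succ, P9, Q9]; ring
lemma Q10 (x y : ℝ) : Q 10 x y =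
    10 * x ^ 9 * y - 120 * x ^ 7 * y ^ 3 + 252 * x ^ 5 * y ^ 5 - 120 * x ^ 3 * y ^ 7 + 10 * x * y ^ 9 := by
  rw [Q_succ, P9, Q9]; ring
lemma P11 (x y : ℝ) : P 11 x y =
    x ^ 11 - 55 * x ^ 9 * y ^ 2 + 330 * x ^ 7 * y ^ 4 - 462 * x ^ 5 * y ^ 6 + 165 * x ^ 3 * y ^ 8 - 11 * x * y ^ 10 := by
  rw [P_succ, P10, Q10]; ring
lemma Q11 (x y : ℝ) : Q 11 x y =
    11 * x ^ 10 * y - 165 * x ^ 8 * y ^ 3 + 462 * x ^ 6 * y ^ 5 - 330 * x ^ 4 * y ^ 7 + 55 * x ^ 2 * y ^ 9 - y ^ 11 := by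
  rw [Q_succ, P10, Q10]; ring
lemma P12 (x y : ℝ) : P 12 x y =
    x ^ 12 - 66 * x ^ 10 * y ^ 2 + 495 * x ^ 8 * y ^ 4 - 924 * x ^ 6 * y ^ 6 + 495 * x ^ 4 * y ^ 8 - 66 * x ^ 2 * y ^ 10 + y ^ 12 := by
  rw [P_succ, P11, Q11]; ring
lemma Q12 (x y : ℝ) : Q 12 x y =
    12 * x ^ 11 * y - 220 * x ^ 9 * y ^ 3 + 792 * x ^ 7 * y ^ 5 - 792 * x ^ 5 * y ^ 7 + 220 * x ^ 3 * y ^ 9 - 12 * x * y ^ 11 := by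
  rw [Q_succ, P11, Q11]; ring
lemma P13 (x y : ℝ) : P 13 x y =
    x ^ 13 - 78 * x ^ 11 * y ^ 2 + 715 * x ^ 9 * y ^ 4 - 1716 * x ^ 7 * y ^ 6 + 1287 * x ^ 5 * y ^ 8 - 286 * x ^ 3 * y ^ 10 + 13 * x * y ^ 12 := by
  rw [P_succ, P12, Q12]; ring
lemma Q13 (x y : ℝ) : Q 13 x y =
    13 * x ^ 12 * y - 286 * x ^ 10 * y ^ 3 + 1287 * x ^ 8 * y ^ 5 - 1716 * x ^ 6 * y ^ 7 + 715 * x ^ 4 * y ^ 9 - 78 * x ^ 2 * y ^ 11 + y ^ 13 := by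
  rw [Q_succ, P12, Q12]; ring
lemma P14 (x y : ℝ) : P 14 x y =
    x ^ 14 - 91 * x ^ 12 * y ^ 2 + 1001 * x ^ 10 * y ^ 4 - 3003 * x ^ 8 * y ^ 6 + 3003 * x ^ 6 * y ^ 8 - 1001 * x ^ 4 * y ^ 10 + 91 * x ^ 2 * y ^ 12 - y ^ 14 := by
  rw [P_succ, P13, Q13]; ring
lemma Q14 (x y : ℝ) : Q 14 x y =
    14 * x ^ 13 * y - 364 * x ^ 11 * y ^ 3 + 2002 * x ^ 9 * y ^ 5 - 3432 * x ^ 7 * y ^ 7 + 2002 * x ^ 5 * y ^ 9 - 364 * x ^ 3 * y ^ 11 + 14 * x * y ^ 13 := by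
  rw [Q_succ, P13, Q13]; ring
/-- coefficients -/
noncomputable def sq_a : ℕ → ℝ
  | 0 => (461 / 6250)
  | 4 => (-182837 / 1000000)
  | 8 => (1249 / 20000)
  | 12 => (-26849 / 250000)
  | _ => 0
/-- coefficients -/
noncomputable def sq_b : ℕ → ℝ
  | _ => 0
/-- coefficients -/
noncomputable def rect_a : ℕ → ℝ
  | 0 => (711 / 6250)
  | 2 => (195067 / 1000000)
  | 4 => (-361 / 8000)
  | 6 => (-6571 / 500000)
  | 8 => (-3101 / 1000000)
  | 10 => (2491 / 1000000)
  | _ => 0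
/-- coefficients -/
noncomputable def rect_b : ℕ → ℝ
  | _ => 0
/-- coefficients -/
noncomputable def tri_a : ℕ → ℝ
  | 0 => (1 / 100000)
  | 1 => (487 / 25000)
  | 3 => (1238919 / 1000000)
  | 4 => (-469 / 160)
  | 5 => (61339 / 20000)
  | 7 => (-2925889 / 1000000)
  | 8 => (597309 / 250000)
  | 9 => (-606717 / 1000000)
  | _ => 0
/-- coefficients -/
noncomputable def tri_b : ℕ → ℝ
  | 1 => (487 / 25000)
  | 2 => (4881 / 6250)
  | 3 => (-1238919 / 1000000)
  | 5 => (61339 / 20000)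
  | 6 => (-2472823 / 500000)
  | 7 => (2925889 / 1000000)
  | 9 => (-606717 / 1000000)
  | 10 => (29159 / 200000)
  | _ => 0
lemma sq_edge (t : ℝ) (h0 : 0 ≤ t) (h1 : t ≤ (1 / 4)) :
    0 ≤ (51623 / 1024000000) + (493521 / 128000000) * t ^ 1 + (-7505823 / 64000000) * t ^ 2 + (4453519 / 4000000) * t ^ 3 + (-2608091 / 800000) * t ^ 4 + (886017 / 500000) * t ^ 5 + (-26849 / 250000) * t ^ 6 := by
  rcases le_total t (1 / 8) with h2 | h2
  · have e1 : 0 ≤ t - 0 := by linarith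
    have e2 : 0 ≤ (1 / 8) - t := by linarith
    calc (0 : ℝ) ≤ (206492 / 15625) * (t - 0) ^ 0 * ((1 / 8) - t) ^ 6 +
          (3213036 / 15625) * (t - 0) ^ 1 * ((1 / 8) - t) ^ 5 +
          (5461977 / 15625) * (t - 0) ^ 2 * ((1 / 8) - t) ^ 4 +
          (2754426 / 15625) * (t - 0) ^ 3 * ((1 / 8) - t) ^ 3 +
          (5057129 / 62500) * (t - 0) ^ 4 * ((1 / 8) - t) ^ 2 +
          (6033883 / 62500) * (t - 0) ^ 5 * ((1 / 8) - t) ^ 1 +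
          (1732811 / 50000) * (t - 0) ^ 6 * ((1 / 8) - t) ^ 0 := by positivity
      _ = _ := by ring
  have e1 : 0 ≤ t - (1 / 8) := by linarith
  have e2 : 0 ≤ (1 / 4) - t := by linarith
  calc (0 : ℝ) ≤ (1732811 / 50000) * (t - (1 / 8)) ^ 0 * ((1 / 4) - t) ^ 6 +
        (9979141 / 31250) * (t - (1 / 8)) ^ 1 * ((1 / 4) - t) ^ 5 +
        (18669781 / 15625) * (t - (1 / 8)) ^ 2 * ((1 / 4) - t) ^ 4 +
        (33661552 / 15625) * (t - (1 / 8)) ^ 3 * ((1 / 4) - t) ^ 3 +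
        (5712272 / 3125) * (t - (1 / 8)) ^ 4 * ((1 / 4) - t) ^ 2 +
        (9329792 / 15625) * (t - (1 / 8)) ^ 5 * ((1 / 4) - t) ^ 1 +
        (206592 / 15625) * (t - (1 / 8)) ^ 6 * ((1 / 4) - t) ^ 0 := by positivity
    _ = _ := by ring
lemma rect_edge1 (t : ℝ) (h0 : 0 ≤ t) (h1 : t ≤ (1 / 4)) :
    0 ≤ (1 / 20000) + (1227 / 500000) * t ^ 1 + (-12757 / 200000) * t ^ 2 + (21157 / 50000) * t ^ 3 + (-54497 / 500000) * t ^ 4 + (2491 / 1000000) * t ^ 5 := by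
  rcases le_total t (1 / 8) with h2 | h2
  · have e1 : 0 ≤ t - 0 := by linarith
    have e2 : 0 ≤ (1 / 8) - t := by linarith
    calc (0 : ℝ) ≤ (1024 / 625) * (t - 0) ^ 0 * ((1 / 8) - t) ^ 5 +
          (285056 / 15625) * (t - 0) ^ 1 * ((1 / 8) - t) ^ 4 +
          (373944 / 15625) * (t - 0) ^ 2 * ((1 / 8) - t) ^ 3 +
          (90636 / 15625) * (t - 0) ^ 3 * ((1 / 8) - t) ^ 2 +
          (232159 / 62500) * (t - 0) ^ 4 * ((1 / 8) - t) ^ 1 +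
          (5243563 / 1000000) * (t - 0) ^ 5 * ((1 / 8) - t) ^ 0 := by positivity
      _ = _ := by ring
  have e1 : 0 ≤ t - (1 / 8) := by linarith
  have e2 : 0 ≤ (1 / 4) - t := by linarith
  calc (0 : ℝ) ≤ (5243563 / 1000000) * (t - (1 / 8)) ^ 0 * ((1 / 4) - t) ^ 5 +
        (24360543 / 500000) * (t - (1 / 8)) ^ 1 * ((1 / 4) - t) ^ 4 +
        (23228359 / 125000) * (t - (1 / 8)) ^ 2 * ((1 / 4) - t) ^ 3 +
        (21325487 / 62500) * (t - (1 / 8)) ^ 3 * ((1 / 4) - t) ^ 2 +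
        (146371 / 500) * (t - (1 / 8)) ^ 4 * ((1 / 4) - t) ^ 1 +
        (2933939 / 31250) * (t - (1 / 8)) ^ 5 * ((1 / 4) - t) ^ 0 := by positivity
    _ = _ := by ring
lemma rect_edge2 (t : ℝ) (h0 : 0 ≤ t) (h1 : t ≤ 1) :
    0 ≤ (27907 / 204800000) + (-570479 / 256000000) * t ^ 1 + (112531 / 6400000) * t ^ 2 + (-13203 / 320000) * t ^ 3 + (124499 / 4000000) * t ^ 4 + (-2491 / 1000000) * t ^ 5 := by
  rcases le_total t (1 / 4) with h2 | h2
  · have e1 : 0 ≤ t - 0 := by linarith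
    have e2 : 0 ≤ (1 / 4) - t := by linarith
    calc (0 : ℝ) ≤ (27907 / 200000) * (t - 0) ^ 0 * ((1 / 4) - t) ^ 5 +
          (31799 / 250000) * (t - 0) ^ 1 * ((1 / 4) - t) ^ 4 +
          (29843 / 125000) * (t - 0) ^ 2 * ((1 / 4) - t) ^ 3 +
          (10754 / 15625) * (t - 0) ^ 3 * ((1 / 4) - t) ^ 2 +
          (37243 / 62500) * (t - 0) ^ 4 * ((1 / 4) - t) ^ 1 +
          (2441 / 15625) * (t - 0) ^ 5 * ((1 / 4) - t) ^ 0 := by positivity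
      _ = _ := by ring
  rcases le_total t (1 / 2) with h2 | h2
  · have e1 : 0 ≤ t - (1 / 4) := by linarith
    have e2 : 0 ≤ (1 / 2) - t := by linarith
    calc (0 : ℝ) ≤ (2441 / 15625) * (t - (1 / 4)) ^ 0 * ((1 / 2) - t) ^ 5 +
          (60397 / 62500) * (t - (1 / 4)) ^ 1 * ((1 / 2) - t) ^ 4 +
          (33908 / 15625) * (t - (1 / 4)) ^ 2 * ((1 / 2) - t) ^ 3 +
          (10437 / 5000) * (t - (1 / 4)) ^ 3 * ((1 / 2) - t) ^ 2 +
          (215199 / 250000) * (t - (1 / 4)) ^ 4 * ((1 / 2) - t) ^ 1 +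
          (130889 / 1000000) * (t - (1 / 4)) ^ 5 * ((1 / 2) - t) ^ 0 := by positivity
      _ = _ := by ring
  rcases le_total t (3 / 4) with h2 | h2
  · have e1 : 0 ≤ t - (1 / 2) := by linarith
    have e2 : 0 ≤ (3 / 4) - t := by linarith
    calc (0 : ℝ) ≤ (130889 / 1000000) * (t - (1 / 2)) ^ 0 * ((3 / 4) - t) ^ 5 +
          (224047 / 500000) * (t - (1 / 2)) ^ 1 * ((3 / 4) - t) ^ 4 +
          (27287 / 62500) * (t - (1 / 2)) ^ 2 * ((3 / 4) - t) ^ 3 +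
          (5197 / 31250) * (t - (1 / 2)) ^ 3 * ((3 / 4) - t) ^ 2 +
          (4068 / 15625) * (t - (1 / 2)) ^ 4 * ((3 / 4) - t) ^ 1 +
          (3296 / 15625) * (t - (1 / 2)) ^ 5 * ((3 / 4) - t) ^ 0 := by positivity
      _ = _ := by ring
  have e1 : 0 ≤ t - (3 / 4) := by linarith
  have e2 : 0 ≤ 1 - t := by linarith
  calc (0 : ℝ) ≤ (3296 / 15625) * (t - (3 / 4)) ^ 0 * (1 - t) ^ 5 +
        (28892 / 15625) * (t - (3 / 4)) ^ 1 * (1 - t) ^ 4 +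
        (203789 / 31250) * (t - (3 / 4)) ^ 2 * (1 - t) ^ 3 +
        (699269 / 62500) * (t - (3 / 4)) ^ 3 * (1 - t) ^ 2 +
        (924163 / 100000) * (t - (3 / 4)) ^ 4 * (1 - t) ^ 1 +
        (2933939 / 1000000) * (t - (3 / 4)) ^ 5 * (1 - t) ^ 0 := by positivity
    _ = _ := by ring
lemma tri_edge1 (t : ℝ) (h0 : 0 ≤ t) (h1 : t ≤ 1) :
    0 ≤ (1 / 100000) + (487 / 25000) * t ^ 1 + (-1 / 4) * t ^ 2 + (1238919 / 1000000) * t ^ 3 + (-469 / 160) * t ^ 4 + (61339 / 20000) * t ^ 5 + (-2925889 / 1000000) * t ^ 7 + (597309 / 250000) * t ^ 8 + (-606717 / 1000000) * t ^ 9 := by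
  rcases le_total t (1 / 4) with h2 | h2
  · have e1 : 0 ≤ t - 0 := by linarith
    have e2 : 0 ≤ (1 / 4) - t := by linarith
    calc (0 : ℝ) ≤ (8192 / 3125) * (t - 0) ^ 0 * ((1 / 4) - t) ^ 9 +
          (4063232 / 3125) * (t - 0) ^ 1 * ((1 / 4) - t) ^ 8 +
          (19410944 / 3125) * (t - 0) ^ 2 * ((1 / 4) - t) ^ 7 +
          (193262016 / 15625) * (t - 0) ^ 3 * ((1 / 4) - t) ^ 6 +
          (207066976 / 15625) * (t - 0) ^ 4 * ((1 / 4) - t) ^ 5 +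
          (5144696 / 625) * (t - 0) ^ 5 * ((1 / 4) - t) ^ 4 +
          (9277856 / 3125) * (t - 0) ^ 6 * ((1 / 4) - t) ^ 3 +
          (36970751 / 62500) * (t - 0) ^ 7 * ((1 / 4) - t) ^ 2 +
          (761023 / 12500) * (t - 0) ^ 8 * ((1 / 4) - t) ^ 1 +
          (3550147 / 1000000) * (t - 0) ^ 9 * ((1 / 4) - t) ^ 0 := by positivity
      _ = _ := by ring
  rcases le_total t (1 / 2) with h2 | h2
  · have e1 : 0 ≤ t - (1 / 4) := by linarith
    have e2 : 0 ≤ (1 / 2) - t := by linarith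
    calc (0 : ℝ) ≤ (3550147 / 1000000) * (t - (1 / 4)) ^ 0 * ((1 / 2) - t) ^ 9 +
          (1510403 / 500000) * (t - (1 / 4)) ^ 1 * ((1 / 2) - t) ^ 8 +
          (4020117 / 31250) * (t - (1 / 4)) ^ 2 * ((1 / 2) - t) ^ 7 +
          (13741672 / 15625) * (t - (1 / 4)) ^ 3 * ((1 / 2) - t) ^ 6 +
          (67977123 / 31250) * (t - (1 / 4)) ^ 4 * ((1 / 2) - t) ^ 5 +
          (8385971 / 3125) * (t - (1 / 4)) ^ 5 * ((1 / 2) - t) ^ 4 +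
          (28563376 / 15625) * (t - (1 / 4)) ^ 6 * ((1 / 2) - t) ^ 3 +
          (10879984 / 15625) * (t - (1 / 4)) ^ 7 * ((1 / 2) - t) ^ 2 +
          (2168444 / 15625) * (t - (1 / 4)) ^ 8 * ((1 / 2) - t) ^ 1 +
          (35544 / 3125) * (t - (1 / 4)) ^ 9 * ((1 / 2) - t) ^ 0 := by positivity
      _ = _ := by ring
  rcases le_total t (5 / 8) with h2 | h2
  · have e1 : 0 ≤ t - (1 / 2) := by linarith
    have e2 : 0 ≤ (5 / 8) - t := by linarith
    calc (0 : ℝ) ≤ (18198528 / 3125) * (t - (1 / 2)) ^ 0 * ((5 / 8) - t) ^ 9 +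
          (673278976 / 15625) * (t - (1 / 2)) ^ 1 * ((5 / 8) - t) ^ 8 +
          (2101581824 / 15625) * (t - (1 / 2)) ^ 2 * ((5 / 8) - t) ^ 7 +
          (723678208 / 3125) * (t - (1 / 2)) ^ 3 * ((5 / 8) - t) ^ 6 +
          (763065952 / 3125) * (t - (1 / 2)) ^ 4 * ((5 / 8) - t) ^ 5 +
          (2669469816 / 15625) * (t - (1 / 2)) ^ 5 * ((5 / 8) - t) ^ 4 +
          (1398187616 / 15625) * (t - (1 / 2)) ^ 6 * ((5 / 8) - t) ^ 3 +
          (122697714 / 3125) * (t - (1 / 2)) ^ 7 * ((5 / 8) - t) ^ 2 +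
          (640555687 / 50000) * (t - (1 / 2)) ^ 8 * ((5 / 8) - t) ^ 1 +
          (404833411 / 200000) * (t - (1 / 2)) ^ 9 * ((5 / 8) - t) ^ 0 := by positivity
      _ = _ := by ring
  rcases le_total t (3 / 4) with h2 | h2
  · have e1 : 0 ≤ t - (5 / 8) := by linarith
    have e2 : 0 ≤ (3 / 4) - t := by linarith
    calc (0 : ℝ) ≤ (404833411 / 200000) * (t - (5 / 8)) ^ 0 * ((3 / 4) - t) ^ 9 +
          (94495573 / 4000) * (t - (5 / 8)) ^ 1 * ((3 / 4) - t) ^ 8 +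
          (1572068807 / 12500) * (t - (5 / 8)) ^ 2 * ((3 / 4) - t) ^ 7 +
          (12049914793 / 31250) * (t - (5 / 8)) ^ 3 * ((3 / 4) - t) ^ 6 +
          (23015448713 / 31250) * (t - (5 / 8)) ^ 4 * ((3 / 4) - t) ^ 5 +
          (2818589011 / 3125) * (t - (5 / 8)) ^ 5 * ((3 / 4) - t) ^ 4 +
          (2207394828 / 3125) * (t - (5 / 8)) ^ 6 * ((3 / 4) - t) ^ 3 +
          (5326569896 / 15625) * (t - (5 / 8)) ^ 7 * ((3 / 4) - t) ^ 2 +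
          (1437728348 / 15625) * (t - (5 / 8)) ^ 8 * ((3 / 4) - t) ^ 1 +
          (165535304 / 15625) * (t - (5 / 8)) ^ 9 * ((3 / 4) - t) ^ 0 := by positivity
      _ = _ := by ring
  rcases le_total t (7 / 8) with h2 | h2
  · have e1 : 0 ≤ t - (3 / 4) := by linarith
    have e2 : 0 ≤ (7 / 8) - t := by linarith
    calc (0 : ℝ) ≤ (165535304 / 15625) * (t - (3 / 4)) ^ 0 * ((7 / 8) - t) ^ 9 +
          (1541907124 / 15625) * (t - (3 / 4)) ^ 1 * ((7 / 8) - t) ^ 8 +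
          (6160000104 / 15625) * (t - (3 / 4)) ^ 2 * ((7 / 8) - t) ^ 7 +
          (13749153716 / 15625) * (t - (3 / 4)) ^ 3 * ((7 / 8) - t) ^ 6 +
          (18697999599 / 15625) * (t - (3 / 4)) ^ 4 * ((7 / 8) - t) ^ 5 +
          (31650889283 / 31250) * (t - (3 / 4)) ^ 5 * ((7 / 8) - t) ^ 4 +
          (3261135517 / 6250) * (t - (3 / 4)) ^ 6 * ((7 / 8) - t) ^ 3 +
          (9574143769 / 62500) * (t - (3 / 4)) ^ 7 * ((7 / 8) - t) ^ 2 +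
          (11535476449 / 500000) * (t - (3 / 4)) ^ 8 * ((7 / 8) - t) ^ 1 +
          (1715618229 / 1000000) * (t - (3 / 4)) ^ 9 * ((7 / 8) - t) ^ 0 := by positivity
      _ = _ := by ring
  have e1 : 0 ≤ t - (7 / 8) := by linarith
  have e2 : 0 ≤ 1 - t := by linarith
  calc (0 : ℝ) ≤ (1715618229 / 1000000) * (t - (7 / 8)) ^ 0 * (1 - t) ^ 9 +
        (976271903 / 125000) * (t - (7 / 8)) ^ 1 * (1 - t) ^ 8 +
        (485938733 / 15625) * (t - (7 / 8)) ^ 2 * (1 - t) ^ 7 +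
        (2996488232 / 15625) * (t - (7 / 8)) ^ 3 * (1 - t) ^ 6 +
        (11593702208 / 15625) * (t - (7 / 8)) ^ 4 * (1 - t) ^ 5 +
        (24918455808 / 15625) * (t - (7 / 8)) ^ 5 * (1 - t) ^ 4 +
        (31234113536 / 15625) * (t - (7 / 8)) ^ 6 * (1 - t) ^ 3 +
        (22931177472 / 15625) * (t - (7 / 8)) ^ 7 * (1 - t) ^ 2 +
        (9177399296 / 15625) * (t - (7 / 8)) ^ 8 * (1 - t) ^ 1 +
        (1549795328 / 15625) * (t - (7 / 8)) ^ 9 * (1 - t) ^ 0 := by positivity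
    _ = _ := by ring
lemma tri_edge2 (t : ℝ) (h0 : 0 ≤ t) (h1 : t ≤ (1 / 4)) :
    0 ≤ (597 / 32000000) + (-9699 / 8000000) * t ^ 1 + (51803 / 1000000) * t ^ 2 + (-171701 / 250000) * t ^ 3 + (418341 / 125000) * t ^ 4 + (-29159 / 6250) * t ^ 5 := by
  rcases le_total t (1 / 16) with h2 | h2
  · have e1 : 0 ≤ t - 0 := by linarith
    have e2 : 0 ≤ (1 / 16) - t := by linarith
    calc (0 : ℝ) ≤ (305664 / 15625) * (t - 0) ^ 0 * ((1 / 16) - t) ^ 5 +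
          (286848 / 15625) * (t - 0) ^ 1 * ((1 / 16) - t) ^ 4 +
          (1406144 / 15625) * (t - 0) ^ 2 * ((1 / 16) - t) ^ 3 +
          (2806768 / 15625) * (t - 0) ^ 3 * ((1 / 16) - t) ^ 2 +
          (1850858 / 15625) * (t - 0) ^ 4 * ((1 / 16) - t) ^ 1 +
          (158461 / 6250) * (t - 0) ^ 5 * ((1 / 16) - t) ^ 0 := by positivity
      _ = _ := by ring
  rcases le_total t (1 / 8) with h2 | h2
  · have e1 : 0 ≤ t - (1 / 16) := by linarith
    have e2 : 0 ≤ (1 / 8) - t := by linarith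
    calc (0 : ℝ) ≤ (158461 / 6250) * (t - (1 / 16)) ^ 0 * ((1 / 8) - t) ^ 5 +
          (2110667 / 15625) * (t - (1 / 16)) ^ 1 * ((1 / 8) - t) ^ 4 +
          (3846004 / 15625) * (t - (1 / 16)) ^ 2 * ((1 / 8) - t) ^ 3 +
          (2706072 / 15625) * (t - (1 / 16)) ^ 3 * ((1 / 8) - t) ^ 2 +
          (808232 / 15625) * (t - (1 / 16)) ^ 4 * ((1 / 8) - t) ^ 1 +
          (160752 / 15625) * (t - (1 / 16)) ^ 5 * ((1 / 8) - t) ^ 0 := by positivity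
      _ = _ := by ring
  have e1 : 0 ≤ t - (1 / 8) := by linarith
  have e2 : 0 ≤ (1 / 4) - t := by linarith
  calc (0 : ℝ) ≤ (10047 / 31250) * (t - (1 / 8)) ^ 0 * ((1 / 4) - t) ^ 5 +
        (24838 / 15625) * (t - (1 / 8)) ^ 1 * ((1 / 4) - t) ^ 4 +
        (7368 / 625) * (t - (1 / 8)) ^ 2 * ((1 / 4) - t) ^ 3 +
        (711392 / 15625) * (t - (1 / 8)) ^ 3 * ((1 / 4) - t) ^ 2 +
        (998272 / 15625) * (t - (1 / 8)) ^ 4 * ((1 / 4) - t) ^ 1 +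
        (378368 / 15625) * (t - (1 / 8)) ^ 5 * ((1 / 4) - t) ^ 0 := by positivity
    _ = _ := by ring
lemma W_sq (x y : ℝ) : W sq_a sq_b 13 x y =
    (461 / 6250) * P 0 x y + (-182837 / 1000000) * P 4 x y + (1249 / 20000) * P 8 x y + (-26849 / 250000) * P 12 x y - (x ^ 2 + y ^ 2) / 4 := by
  simp only [W, Finset.sum_range_succ, Finset.sum_range_zero, sq_a, sq_b]
  ring
lemma W2_sq (x y : ℝ) : W2 sq_a sq_b 13 x y =
    (461 / 6250) * (Q 2 x y) / 2 + (-182837 / 1000000) * (Q 6 x y) / 30 + (1249 / 20000) * (Q 10 x y) / 90 + (-26849 / 250000) * (Q 14 x y) / 182 - (x ^ 3 / 3 * y + x * (y ^ 3 / 3)) / 4 := by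
  simp only [W2, Finset.sum_range_succ, Finset.sum_range_zero, sq_a, sq_b]
  push_cast
  ring
lemma W_rect (x y : ℝ) : W rect_a rect_b 11 x y =
    (711 / 6250) * P 0 x y + (195067 / 1000000) * P 2 x y + (-361 / 8000) * P 4 x y + (-6571 / 500000) * P 6 x y + (-3101 / 1000000) * P 8 x y + (2491 / 1000000) * P 10 x y - (x ^ 2 + y ^ 2) / 4 := by
  simp only [W, Finset.sum_range_succ, Finset.sum_range_zero, rect_a, rect_b]
  ring
lemma W2_rect (x y : ℝ) : W2 rect_a rect_b 11 x y =
    (711 / 6250) * (Q 2 x y) / 2 + (195067 / 1000000) * (Q 4 x y) / 12 + (-361 / 8000) * (Q 6 x y) / 30 + (-6571 / 500000) * (Q 8 x y) / 56 + (-3101 / 1000000) * (Q 10 x y) / 90 + (2491 / 1000000) * (Q 12 x y) / 132 - (x ^ 3 / 3 * y + x * (y ^ 3 / 3)) / 4 := by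
  simp only [W2, Finset.sum_range_succ, Finset.sum_range_zero, rect_a, rect_b]
  push_cast
  ring
lemma W_tri (x y : ℝ) : W tri_a tri_b 11 x y =
    (1 / 100000) * P 0 x y + (487 / 25000) * P 1 x y + (487 / 25000) * Q 1 x y + (4881 / 6250) * Q 2 x y + (1238919 / 1000000) * P 3 x y + (-1238919 / 1000000) * Q 3 x y + (-469 / 160) * P 4 x y + (61339 / 20000) * P 5 x y + (61339 / 20000) * Q 5 x y + (-2472823 / 500000) * Q 6 x y + (-2925889 / 1000000) * P 7 x y + (2925889 / 1000000) * Q 7 x y + (597309 / 250000) * P 8 x y + (-606717 / 1000000) * P 9 x y + (-606717 / 1000000) * Q 9 x y + (29159 / 200000) * Q 10 x y - (x ^ 2 + y ^ 2) / 4 := by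
  simp only [W, Finset.sum_range_succ, Finset.sum_range_zero, tri_a, tri_b]
  ring
lemma W2_tri (x y : ℝ) : W2 tri_a tri_b 11 x y =
    (1 / 100000) * (Q 2 x y) / 2 + (487 / 25000) * (Q 3 x y) / 6 + (487 / 25000) * (-P 3 x y) / 6 + (4881 / 6250) * (-P 4 x y) / 12 + (1238919 / 1000000) * (Q 5 x y) / 20 + (-1238919 / 1000000) * (-P 5 x y) / 20 + (-469 / 160) * (Q 6 x y) / 30 + (61339 / 20000) * (Q 7 x y) / 42 + (61339 / 20000) * (-P 7 x y) / 42 + (-2472823 / 500000) * (-P 8 x y) / 56 + (-2925889 / 1000000) * (Q 9 x y) / 72 + (2925889 / 1000000) * (-P 9 x y) / 72 + (597309 / 250000) * (Q 10 x y) / 90 + (-606717 / 1000000) * (Q 11 x y) / 110 + (-606717 / 1000000) * (-P 11 x y) / 110 + (29159 / 200000) * (-P 12 x y) / 132 - (x ^ 3 / 3 * y + x * (y ^ 3 / 3)) / 4 := by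
  simp only [W2, Finset.sum_range_succ, Finset.sum_range_zero, tri_a, tri_b]
  push_cast
  ring

lemma int_sq : ∫ q in Set.Ioo (0 : ℝ) 1 ×ˢ Set.Ioo (0 : ℝ) 1, W sq_a sq_b 13 (q.1 - 1 / 2) (q.2 - 1 / 2)
    < 0.035246 := by
  rw [integral_W_rect _ _ _ _ _ _ _ zero_le_one zero_le_one]
  simp only [W2_sq, P2, Q2, Q6, Q10, Q14]
  norm_num

lemma int_rect : 0.114045 <
    ∫ q in Set.Ioo (0 : ℝ) 2 ×ˢ Set.Ioo (0 : ℝ) 1, W rect_a rect_b 11 (q.1 - 1) (q.2 - 1 / 2) := by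
  rw [integral_W_rect _ _ _ _ _ _ _ zero_le_two zero_le_one]
  simp only [W2_rect, Q2, Q4, Q6, Q8, Q10, Q12]
  norm_num

lemma int_tri : ∫ q in tri 1, W tri_a tri_b 11 q.1 q.2 < 0.006554 := by
  rw [integral_W_tri]
  simp only [W2_tri]
  simp only [W3, Finset.sum_range_succ, Finset.sum_range_zero, tri_a, tri_b]
  simp only [zero_add, Nat.reduceAdd, P2, Q2, P3, Q3, P4, Q4, P5, Q5, P6, Q6, P7, Q7, P8, Q8, P9, Q9,
    P10, Q10, P11, Q11, P12, Q12]
  norm_num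

lemma isOpen_rect (A B : ℝ) : IsOpen (Set.Ioo (0 : ℝ) A ×ˢ Set.Ioo (0 : ℝ) B) :=
  isOpen_Ioo.prod isOpen_Ioo

lemma isBounded_rect (A B : ℝ) : Bornology.IsBounded (Set.Ioo (0 : ℝ) A ×ˢ Set.Ioo (0 : ℝ) B) :=
  (Metric.isBounded_Ioo _ _).prod (Metric.isBounded_Ioo _ _)

lemma frontier_rect {A B : ℝ} {p : ℝ × ℝ}
    (hp : p ∈ frontier (Set.Ioo (0 : ℝ) A ×ˢ Set.Ioo (0 : ℝ) B)) :
    (0 ≤ p.1 ∧ p.1 ≤ A) ∧ (0 ≤ p.2 ∧ p.2 ≤ B) ∧ (p.1 = 0 ∨ p.1 = A ∨ p.2 = 0 ∨ p.2 = B) := by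
  rw [frontier, (isOpen_rect A B).interior_eq] at hp
  obtain ⟨h1, h2⟩ := hp
  have hc : closure (Set.Ioo (0 : ℝ) A ×ˢ Set.Ioo (0 : ℝ) B) ⊆ Set.Icc (0 : ℝ) A ×ˢ Set.Icc (0 : ℝ) B :=
    closure_minimal (Set.prod_mono Set.Ioo_subset_Icc_self Set.Ioo_subset_Icc_self)
      (isClosed_Icc.prod isClosed_Icc)
  obtain ⟨⟨a1, a2⟩, ⟨b1, b2⟩⟩ := hc h1
  refine ⟨⟨a1, a2⟩, ⟨b1, b2⟩, ?_⟩
  by_contra hcon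
  push Not at hcon
  obtain ⟨c1, c2, c3, c4⟩ := hcon
  exact h2 ⟨⟨lt_of_le_of_ne a1 c1.symm, lt_of_le_of_ne a2 c2⟩,
    ⟨lt_of_le_of_ne b1 c3.symm, lt_of_le_of_ne b2 c4⟩⟩

lemma frontier_tri {p : ℝ × ℝ} (hp : p ∈ frontier (tri 1)) :
    0 ≤ p.1 ∧ 0 ≤ p.2 ∧ p.1 + p.2 ≤ 1 ∧ (p.1 = 0 ∨ p.2 = 0 ∨ p.1 + p.2 = 1) := by
  rw [frontier, (isOpen_tri 1).interior_eq] at hp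
  obtain ⟨h1, h2⟩ := hp
  obtain ⟨a1, a2, a3⟩ := closure_tri 1 h1
  refine ⟨a1, a2, a3, ?_⟩
  by_contra hcon
  push Not at hcon
  obtain ⟨c1, c2, c3⟩ := hcon
  exact h2 ⟨lt_of_le_of_ne a1 c1.symm, lt_of_le_of_ne a2 c2.symm, lt_of_le_of_ne a3 c3⟩

lemma sq_quarter {t : ℝ} (h0 : 0 ≤ t) (h1 : t ≤ 1) : (t - 1 / 2) ^ 2 ≤ 1 / 4 := by nlinarith

lemma W_sq_symm1 (x y : ℝ) : W sq_a sq_b 13 (-x) y = W sq_a sq_b 13 x y := by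
  simp only [W_sq, P_zero, P4, P8, P12]; ring
lemma W_sq_symm2 (x y : ℝ) : W sq_a sq_b 13 y x = W sq_a sq_b 13 x y := by
  simp only [W_sq, P_zero, P4, P8, P12]; ring
lemma W_sq_edge (y : ℝ) (hy : y ^ 2 ≤ 1 / 4) : 0 ≤ W sq_a sq_b 13 (1 / 2) y := by
  refine (sq_edge (y ^ 2) (sq_nonneg y) hy).trans_eq ?_
  simp only [W_sq, P_zero, P4, P8, P12]; ring

lemma W_rect_symm1 (x y : ℝ) : W rect_a rect_b 11 (-x) y = W rect_a rect_b 11 x y := by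
  simp only [W_rect, P_zero, P2, P4, P6, P8, P10]; ring
lemma W_rect_symm2 (x y : ℝ) : W rect_a rect_b 11 x (-y) = W rect_a rect_b 11 x y := by
  simp only [W_rect, P_zero, P2, P4, P6, P8, P10]; ring
lemma W_rect_edge1 (y : ℝ) (hy : y ^ 2 ≤ 1 / 4) : W rect_a rect_b 11 1 y ≤ 0 := by
  have := rect_edge1 (y ^ 2) (sq_nonneg y) hy
  rw [← neg_nonneg]
  refine this.trans_eq ?_
  simp only [W_rect, P_zero, P2, P4, P6, P8, P10]; ring
lemma W_rect_edge2 (x : ℝ) (hx : x ^ 2 ≤ 1) : W rect_a rect_b 11 x (1 / 2) ≤ 0 := by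
  have := rect_edge2 (x ^ 2) (sq_nonneg x) hx
  rw [← neg_nonneg]
  refine this.trans_eq ?_
  simp only [W_rect, P_zero, P2, P4, P6, P8, P10]; ring

lemma W_tri_symm (x y : ℝ) : W tri_a tri_b 11 y x = W tri_a tri_b 11 x y := by
  simp only [W_tri, P_zero, P1, Q1, Q2, P3, Q3, P4, P5, Q5, Q6, P7, Q7, P8, P9, Q9, Q10]; ring
lemma W_tri_edge1 (x : ℝ) (h0 : 0 ≤ x) (h1 : x ≤ 1) : 0 ≤ W tri_a tri_b 11 x 0 := by
  refine (tri_edge1 x h0 h1).trans_eq ?_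
  simp only [W_tri, P_zero, P1, Q1, Q2, P3, Q3, P4, P5, Q5, Q6, P7, Q7, P8, P9, Q9, Q10]; ring
lemma W_tri_edge2 (x : ℝ) (h0 : 0 ≤ x) (h1 : x ≤ 1) : 0 ≤ W tri_a tri_b 11 x (1 - x) := by
  refine (tri_edge2 ((x - 1 / 2) ^ 2) (sq_nonneg _) (sq_quarter h0 h1)).trans_eq ?_
  simp only [W_tri, P_zero, P1, Q1, Q2, P3, Q3, P4, P5, Q5, Q6, P7, Q7, P8, P9, Q9, Q10]; ring

lemma tor_sq {u : ℝ × ℝ → ℝ} (hu : IsTor (Set.Ioo (0 : ℝ) 1 ×ˢ Set.Ioo (0 : ℝ) 1) u) :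
    ∫ p in Set.Ioo (0 : ℝ) 1 ×ˢ Set.Ioo (0 : ℝ) 1, u p < 0.035246 := by
  obtain ⟨h1, h2, h3, h4⟩ := hu
  refine lt_of_le_of_lt (integral_le (isOpen_rect 1 1) (isBounded_rect 1 1) h1 h2
    (contDiff_Ws sq_a sq_b 13 (1 / 2) (1 / 2)).continuous.continuousOn
    (contDiff_Ws sq_a sq_b 13 (1 / 2) (1 / 2)).contDiffOn ?_ ?_) int_sq
  · intro p hp
    rw [lap_W, h3 p hp]
  · intro p hp
    rw [h4 p hp]
    obtain ⟨⟨a1, a2⟩, ⟨b1, b2⟩, h⟩ := frontier_rect hp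
    have ha := sq_quarter a1 a2
    have hb := sq_quarter b1 b2
    rcases h with h | h | h | h
    · rw [h, zero_sub, W_sq_symm1]; exact W_sq_edge _ hb
    · rw [h, show (1 : ℝ) - 1 / 2 = 1 / 2 by norm_num]; exact W_sq_edge _ hb
    · rw [h, zero_sub, W_sq_symm2, W_sq_symm1]; exact W_sq_edge _ ha
    · rw [h, show (1 : ℝ) - 1 / 2 = 1 / 2 by norm_num, W_sq_symm2]; exact W_sq_edge _ ha

lemma tor_rect {u : ℝ × ℝ → ℝ} (hu : IsTor (Set.Ioo (0 : ℝ) 2 ×ˢ Set.Ioo (0 : ℝ) 1) u) :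
    0.114045 < ∫ p in Set.Ioo (0 : ℝ) 2 ×ˢ Set.Ioo (0 : ℝ) 1, u p := by
  obtain ⟨h1, h2, h3, h4⟩ := hu
  refine lt_of_lt_of_le int_rect (integral_le (isOpen_rect 2 1) (isBounded_rect 2 1)
    (contDiff_Ws rect_a rect_b 11 1 (1 / 2)).continuous.continuousOn
    (contDiff_Ws rect_a rect_b 11 1 (1 / 2)).contDiffOn h1 h2 ?_ ?_)
  · intro p hp
    rw [lap_W, h3 p hp]
  · intro p hp
    rw [h4 p hp]
    obtain ⟨⟨a1, a2⟩, ⟨b1, b2⟩, h⟩ := frontier_rect hp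
    have ha : (p.1 - 1) ^ 2 ≤ 1 := by nlinarith
    have hb := sq_quarter b1 b2
    rcases h with h | h | h | h
    · rw [h, zero_sub, W_rect_symm1]; exact W_rect_edge1 _ hb
    · rw [h, show (2 : ℝ) - 1 = 1 by norm_num]; exact W_rect_edge1 _ hb
    · rw [h, zero_sub, W_rect_symm2]; exact W_rect_edge2 _ ha
    · rw [h, show (1 : ℝ) - 1 / 2 = 1 / 2 by norm_num]; exact W_rect_edge2 _ ha

lemma tor_tri {u : ℝ × ℝ → ℝ} (hu : IsTor (tri 1) u) : ∫ p in tri 1, u p < 0.006554 := by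
  obtain ⟨h1, h2, h3, h4⟩ := hu
  refine lt_of_le_of_lt (integral_le (isOpen_tri 1) (isBounded_tri 1) h1 h2
    (contDiff_W tri_a tri_b 11).continuous.continuousOn
    (contDiff_W tri_a tri_b 11).contDiffOn ?_ ?_) int_tri
  · intro p hp
    have := lap_W tri_a tri_b 11 0 0 p
    simp only [sub_zero] at this
    rw [this, h3 p hp]
  · intro p hp
    rw [h4 p hp]
    obtain ⟨a1, a2, a3, h⟩ := frontier_tri hp
    rcases h with h | h | h
    · rw [h, W_tri_symm]; exact W_tri_edge1 _ a2 (by linarith)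
    · rw [h]; exact W_tri_edge1 _ a1 (by linarith)
    · rw [show p.2 = 1 - p.1 by linarith]; exact W_tri_edge2 _ a1 (by linarith)

end Chapman

/-- The torsion functions of the components of the Chapman domains satisfy
`∫_{r₁} u_{r₁} + ∫_{t₁} u_{t₁} < ∫_{r₂} u_{r₂} + ∫_{t₂} u_{t₂}`; in particular the
torsional rigidities of the Chapman domains `C₁ = r₁ ∪ t₁` and `C₂ = r₂ ∪ t₂`
(with components placed disjointly) are different. -/
theorem chapman_torsional_rigidity_lt
    (r₁ r₂ t₁ t₂ : Set (ℝ × ℝ))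
    (hr₁ : r₁ = Set.Ioo (0 : ℝ) 1 ×ˢ Set.Ioo (0 : ℝ) 1)
    (hr₂ : r₂ = Set.Ioo (0 : ℝ) 2 ×ˢ Set.Ioo (0 : ℝ) 1)
    (ht₁ : t₁ = {p : ℝ × ℝ | 0 < p.1 ∧ 0 < p.2 ∧ p.1 + p.2 < 2})
    (ht₂ : t₂ = {p : ℝ × ℝ | 0 < p.1 ∧ 0 < p.2 ∧ p.1 + p.2 < Real.sqrt 2})
    (ur₁ ur₂ ut₁ ut₂ : ℝ × ℝ → ℝ)
    (hur₁c : ContinuousOn ur₁ (closure r₁)) (hur₁s : ContDiffOn ℝ 2 ur₁ r₁)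
    (hur₁pde : ∀ p ∈ r₁,
      deriv (fun x : ℝ => deriv (fun x' : ℝ => ur₁ (x', p.2)) x) p.1 +
        deriv (fun y : ℝ => deriv (fun y' : ℝ => ur₁ (p.1, y')) y) p.2 = -1)
    (hur₁bd : ∀ p ∈ frontier r₁, ur₁ p = 0)
    (hur₂c : ContinuousOn ur₂ (closure r₂)) (hur₂s : ContDiffOn ℝ 2 ur₂ r₂)
    (hur₂pde : ∀ p ∈ r₂,
      deriv (fun x : ℝ => deriv (fun x' : ℝ => ur₂ (x', p.2)) x) p.1 +
        deriv (fun y : ℝ => deriv (fun y' : ℝ => ur₂ (p.1, y')) y) p.2 = -1)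
    (hur₂bd : ∀ p ∈ frontier r₂, ur₂ p = 0)
    (hut₁c : ContinuousOn ut₁ (closure t₁)) (hut₁s : ContDiffOn ℝ 2 ut₁ t₁)
    (hut₁pde : ∀ p ∈ t₁,
      deriv (fun x : ℝ => deriv (fun x' : ℝ => ut₁ (x', p.2)) x) p.1 +
        deriv (fun y : ℝ => deriv (fun y' : ℝ => ut₁ (p.1, y')) y) p.2 = -1)
    (hut₁bd : ∀ p ∈ frontier t₁, ut₁ p = 0)
    (hut₂c : ContinuousOn ut₂ (closure t₂)) (hut₂s : ContDiffOn ℝ 2 ut₂ t₂)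
    (hut₂pde : ∀ p ∈ t₂,
      deriv (fun x : ℝ => deriv (fun x' : ℝ => ut₂ (x', p.2)) x) p.1 +
        deriv (fun y : ℝ => deriv (fun y' : ℝ => ut₂ (p.1, y')) y) p.2 = -1)
    (hut₂bd : ∀ p ∈ frontier t₂, ut₂ p = 0) :
    (∫ p in r₁, ur₁ p) + (∫ p in t₁, ut₁ p) <
      (∫ p in r₂, ur₂ p) + (∫ p in t₂, ut₂ p) := by
  subst hr₁ hr₂ ht₁ ht₂
  have k1 := Chapman.tor_sq ⟨hur₁c, hur₁s, hur₁pde, hur₁bd⟩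
  have k2 := Chapman.tor_rect ⟨hur₂c, hur₂s, hur₂pde, hur₂bd⟩
  have ht1 : Chapman.IsTor (Chapman.tri 2) ut₁ := ⟨hut₁c, hut₁s, hut₁pde, hut₁bd⟩
  have ht2 : Chapman.IsTor (Chapman.tri (Real.sqrt 2)) ut₂ := ⟨hut₂c, hut₂s, hut₂pde, hut₂bd⟩
  obtain ⟨m1, i1⟩ := Chapman.tor_scale two_pos ht1
  obtain ⟨m2, i2⟩ := Chapman.tor_scale (Real.sqrt_pos.2 two_pos) ht2
  have he := m1.integral_eq (Chapman.isOpen_tri 1) (Chapman.isBounded_tri 1) m2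
  have k3 := Chapman.tor_tri m1
  rw [← he] at i2
  have h4 : Real.sqrt 2 ^ 4 = 4 := by
    rw [show Real.sqrt 2 ^ 4 = (Real.sqrt 2 ^ 2) ^ 2 by ring, Real.sq_sqrt zero_le_two]; norm_num
  rw [h4] at i2
  change (∫ p in Set.Ioo (0 : ℝ) 1 ×ˢ Set.Ioo (0 : ℝ) 1, ur₁ p) + (∫ p in Chapman.tri 2, ut₁ p) <
    (∫ p in Set.Ioo (0 : ℝ) 2 ×ˢ Set.Ioo (0 : ℝ) 1, ur₂ p) +
      (∫ p in Chapman.tri (Real.sqrt 2), ut₂ p)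
  rw [i1, i2]
  linarith
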